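/- Let d ≥ 2 be an integer and W_d(1) the antisymmetric Werner state. Then for every real K > 0, F_Γ(W_d(1);K) = min(1, (d+2)/(dK)), and D_Γ(W_d(1)) = log₂((d+2)/d). Moreover, for any state ρ on any bipartite system, F_Γ(ρ ⊗ W_d(1); K) = F_Γ(ρ; dK/(d+2)) and D_Γ(ρ ⊗ W_d(1)) = D_Γ(ρ) + D_Γ(W_d(1)), where ρ ⊗ W_d(1) is regarded as a state on the bipartite system grouping the two first factors against the two second factors. -/

import Mathlib

open Matrix Filter
open scoped ComplexOrder

noncomputable section

/-- Partial transpose on the second tensor factor: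
`ptrans M ((i,j),(k,l)) = M ((i,l),(k,j))`. -/
def ptrans {ι κ : Type*} (M : Matrix (ι × κ) (ι × κ) ℂ) : Matrix (ι × κ) (ι × κ) ℂ :=
  fun x y => M (x.1, y.2) (y.1, x.2)

/-- Fidelity of `K`-state p.p.t. distillation:
the supremum of `Tr(Fρ)` over Hermitian `F` with `0 ≤ F ≤ 1` and `-1/K ≤ F^Γ ≤ 1/K`. -/
def FGamma {ι κ : Type*} [Fintype ι] [Fintype κ] [DecidableEq ι] [DecidableEq κ]
    (ρ : Matrix (ι × κ) (ι × κ) ℂ) (K : ℝ) : ℝ :=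
  sSup {x : ℝ | ∃ F : Matrix (ι × κ) (ι × κ) ℂ,
    F.PosSemidef ∧ (1 - F).PosSemidef ∧
    (((1 / K : ℝ) : ℂ) • 1 - ptrans F).PosSemidef ∧
    (ptrans F + ((1 / K : ℝ) : ℂ) • 1).PosSemidef ∧
    x = ((F * ρ).trace).re}

/-- `n`-fold tensor power of a bipartite matrix, regrouped as a bipartite matrix. -/
def tpow {ι κ : Type*} (ρ : Matrix (ι × κ) (ι × κ) ℂ) (n : ℕ) :
    Matrix ((Fin n → ι) × (Fin n → κ)) ((Fin n → ι) × (Fin n → κ)) ℂ :=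
  fun x y => ∏ i, ρ (x.1 i, x.2 i) (y.1 i, y.2 i)

/-- p.p.t. distillable entanglement. -/
def DGamma {ι κ : Type*} [Fintype ι] [Fintype κ] [DecidableEq ι] [DecidableEq κ]
    (ρ : Matrix (ι × κ) (ι × κ) ℂ) : ℝ :=
  sSup {r : ℝ | 0 ≤ r ∧
    Tendsto (fun n : ℕ => FGamma (tpow ρ n) ((⌊(2 : ℝ) ^ (r * (n : ℝ))⌋ : ℤ) : ℝ))
      atTop (nhds 1)}

/-- The maximally entangled state `Φ(d) = (1/d) ∑ |ii⟩⟨jj|`. -/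
def maxEnt (d : ℕ) : Matrix (Fin d × Fin d) (Fin d × Fin d) ℂ :=
  fun x y => if x.1 = x.2 ∧ y.1 = y.2 then (1 / (d : ℂ)) else 0

/-- The Werner state `W_d(p) = ((1-p)/(d²+d))(1+T) + (p/(d²-d))(1-T)` where
`T = d Φ(d)^Γ` is the swap operator. -/
def werner (d : ℕ) (p : ℝ) : Matrix (Fin d × Fin d) (Fin d × Fin d) ℂ :=
  (((1 - p) / ((d : ℝ) ^ 2 + d) : ℝ) : ℂ) • (1 + (d : ℂ) • ptrans (maxEnt d)) +
    ((p / ((d : ℝ) ^ 2 - d) : ℝ) : ℂ) • (1 - (d : ℂ) • ptrans (maxEnt d))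

/-- Tensor product of two bipartite matrices, regrouped as a bipartite matrix
(first factors against second factors). -/
def tensorBip {ι₁ κ₁ ι₂ κ₂ : Type*}
    (ρ₁ : Matrix (ι₁ × κ₁) (ι₁ × κ₁) ℂ) (ρ₂ : Matrix (ι₂ × κ₂) (ι₂ × κ₂) ℂ) :
    Matrix ((ι₁ × ι₂) × (κ₁ × κ₂)) ((ι₁ × ι₂) × (κ₁ × κ₂)) ℂ :=
  fun x y => ρ₁ (x.1.1, x.2.1) (y.1.1, y.2.1) * ρ₂ (x.1.2, x.2.2) (y.1.2, y.2.2)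

section Tensor

variable {ι κ ι' κ' : Type*}

/-- Partial trace over the second bipartite system of `M * (1 ⊗ N)`. -/
def ptraceMul [Fintype ι'] [Fintype κ']
    (M : Matrix ((ι × ι') × (κ × κ')) ((ι × ι') × (κ × κ')) ℂ)
    (N : Matrix (ι' × κ') (ι' × κ') ℂ) : Matrix (ι × κ) (ι × κ) ℂ :=
  fun p q => ∑ x : ι' × κ', ∑ y : ι' × κ',
    M ((p.1, x.1), (p.2, x.2)) ((q.1, y.1), (q.2, y.2)) * N y x

lemma ptraceMul_apply [Fintype ι'] [Fintype κ']
    (M : Matrix ((ι × ι') × (κ × κ')) ((ι × ι') × (κ × κ')) ℂ)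
    (N : Matrix (ι' × κ') (ι' × κ') ℂ) (p q : ι × κ) :
    ptraceMul M N p q = ∑ x : ι' × κ', ∑ y : ι' × κ',
      M ((p.1, x.1), (p.2, x.2)) ((q.1, y.1), (q.2, y.2)) * N y x := rfl

lemma tensorBip_eq_submatrix (A : Matrix (ι × κ) (ι × κ) ℂ) (B : Matrix (ι' × κ') (ι' × κ') ℂ) :
    tensorBip A B = (kroneckerMap (· * ·) A B).submatrix
      (Equiv.prodProdProdComm ι ι' κ κ') (Equiv.prodProdProdComm ι ι' κ κ') := rfl

lemma Matrix.PosSemidef.tensorBip [Fintype ι] [Fintype κ] [Fintype ι'] [Fintype κ']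
   {A : Matrix (ι × κ) (ι × κ) ℂ}
    {B : Matrix (ι' × κ') (ι' × κ') ℂ} (hA : A.PosSemidef) (hB : B.PosSemidef) :
    (tensorBip A B).PosSemidef := by
  rw [tensorBip_eq_submatrix]
  exact (hA.kronecker hB).submatrix _

lemma Matrix.PosSemidef.ptraceMul [Fintype ι] [Fintype κ] [Fintype ι'] [Fintype κ']
    [DecidableEq ι] [DecidableEq κ]
   
    {M : Matrix ((ι × ι') × (κ × κ')) ((ι × ι') × (κ × κ')) ℂ}
    {N : Matrix (ι' × κ') (ι' × κ') ℂ} (hM : M.PosSemidef) (hN : N.PosSemidef) :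
    (ptraceMul M N).PosSemidef := by
  let f : (ι × κ) × (ι' × κ') → ((ι × ι') × (κ × κ')) × (ι' × κ') :=
    fun z => (((z.1.1, z.2.1), (z.1.2, z.2.2)), z.2)
  let U : Matrix ((ι × κ) × (ι' × κ')) (ι × κ) ℂ := Matrix.of fun z q => if z.1 = q then 1 else 0
  have h := ((hM.kronecker hN.transpose).submatrix f).conjTranspose_mul_mul_same U
  suffices hU : _root_.ptraceMul M N =
      Uᴴ * (kroneckerMap (· * ·) M Nᵀ).submatrix f f * U by
    rw [hU]
    exact h
  ext p q
  rw [Matrix.mul_apply]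
  simp_rw [Matrix.mul_apply]
  simp only [ptraceMul_apply, conjTranspose_apply, submatrix_apply, U, f, Matrix.of_apply,
    Fintype.sum_prod_type (α₁ := ι × κ), kroneckerMap_apply, transpose_apply]
  simp only [apply_ite star, star_one, star_zero, mul_ite, mul_one, mul_zero, ite_mul, one_mul,
    zero_mul, Finset.sum_ite_irrel, Finset.sum_const_zero, Finset.sum_ite_eq', Finset.mem_univ,
    if_true]
  rw [Finset.sum_comm]

lemma ptrans_ptraceMul [Fintype ι'] [Fintype κ']
    (M : Matrix ((ι × ι') × (κ × κ')) ((ι × ι') × (κ × κ')) ℂ)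
    (N : Matrix (ι' × κ') (ι' × κ') ℂ) :
    ptrans (ptraceMul M N) = ptraceMul (ptrans M) (ptrans N) := by
  ext p q
  simp only [ptrans, ptraceMul, Fintype.sum_prod_type]
  refine Finset.sum_congr rfl fun i _ => ?_
  rw [Finset.sum_comm]
  conv_rhs => rw [Finset.sum_comm]
  refine Finset.sum_congr rfl fun j _ => ?_
  rw [Finset.sum_comm]

lemma ptrans_tensorBip (A : Matrix (ι × κ) (ι × κ) ℂ) (B : Matrix (ι' × κ') (ι' × κ') ℂ) :
    ptrans (tensorBip A B) = tensorBip (ptrans A) (ptrans B) := rfl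

lemma trace_mul_tensorBip [Fintype ι] [Fintype κ] [Fintype ι'] [Fintype κ']
    (M : Matrix ((ι × ι') × (κ × κ')) ((ι × ι') × (κ × κ')) ℂ)
    (A : Matrix (ι × κ) (ι × κ) ℂ) (N : Matrix (ι' × κ') (ι' × κ') ℂ) :
    (M * tensorBip A N).trace = (ptraceMul M N * A).trace := by
  simp only [trace, diag_apply, mul_apply, ptraceMul, tensorBip, Finset.sum_mul]
  rw [← (Equiv.prodProdProdComm ι ι' κ κ').symm.sum_comp, Fintype.sum_prod_type]
  refine Finset.sum_congr rfl fun p _ => ?_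
  simp_rw [← (Equiv.prodProdProdComm ι ι' κ κ').symm.sum_comp (fun j => M _ j * _)]
  simp_rw [Fintype.sum_prod_type (α₁ := ι × κ)]
  rw [Finset.sum_comm]
  refine Finset.sum_congr rfl fun q _ => Finset.sum_congr rfl fun x _ =>
    Finset.sum_congr rfl fun y _ => ?_
  simp only [Equiv.prodProdProdComm_symm, Equiv.prodProdProdComm_apply]
  ring

lemma trace_tensorBip [Fintype ι] [Fintype κ] [Fintype ι'] [Fintype κ']
    (A : Matrix (ι × κ) (ι × κ) ℂ) (N : Matrix (ι' × κ') (ι' × κ') ℂ) :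
    (tensorBip A N).trace = A.trace * N.trace := by
  rw [tensorBip_eq_submatrix, ← trace_kronecker]
  exact (Equiv.prodProdProdComm ι ι' κ κ').sum_comp fun x => kroneckerMap (· * ·) A N x x

lemma tensorBip_mul_tensorBip [Fintype ι] [Fintype κ] [Fintype ι'] [Fintype κ']
    (A B : Matrix (ι × κ) (ι × κ) ℂ)
    (C D : Matrix (ι' × κ') (ι' × κ') ℂ) :
    tensorBip A C * tensorBip B D = tensorBip (A * B) (C * D) := by
  simp only [tensorBip_eq_submatrix]
  rw [submatrix_mul_equiv]
  congr 1
  exact (mul_kronecker_mul A B C D).symm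

lemma tensorBip_one_one [DecidableEq ι] [DecidableEq κ] [DecidableEq ι'] [DecidableEq κ']
    : tensorBip (1 : Matrix (ι × κ) (ι × κ) ℂ)
    (1 : Matrix (ι' × κ') (ι' × κ') ℂ) = 1 := by
  rw [tensorBip_eq_submatrix]
  exact (congrArg (fun X => Matrix.submatrix X _ _) one_kronecker_one).trans (submatrix_one_equiv _)

lemma ptraceMul_one [Fintype ι'] [Fintype κ'] [DecidableEq ι] [DecidableEq κ]
    [DecidableEq ι'] [DecidableEq κ']
    (N : Matrix (ι' × κ') (ι' × κ') ℂ) :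
    ptraceMul (1 : Matrix ((ι × ι') × (κ × κ')) ((ι × ι') × (κ × κ')) ℂ) N = N.trace • 1 := by
  ext p q
  obtain ⟨i, k⟩ := p
  obtain ⟨j, l⟩ := q
  have (x y : ι' × κ') : (1 : Matrix ((ι × ι') × (κ × κ')) ((ι × ι') × (κ × κ')) ℂ)
      ((i, x.1), (k, x.2)) ((j, y.1), (l, y.2)) =
      (1 : Matrix (ι × κ) (ι × κ) ℂ) (i, k) (j, l) * if x = y then 1 else 0 := by
    simp only [one_apply, Prod.ext_iff]
    split_ifs <;> simp_all
  simp [ptraceMul, this, trace, Finset.mul_sum, mul_comm]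

lemma ptraceMul_add_left [Fintype ι'] [Fintype κ']
    (M M' : Matrix ((ι × ι') × (κ × κ')) ((ι × ι') × (κ × κ')) ℂ)
    (N : Matrix (ι' × κ') (ι' × κ') ℂ) :
    ptraceMul (M + M') N = ptraceMul M N + ptraceMul M' N := by
  ext p q
  simp [ptraceMul, add_mul, Finset.sum_add_distrib]

lemma ptraceMul_smul_left [Fintype ι'] [Fintype κ']
    (c : ℂ) (M : Matrix ((ι × ι') × (κ × κ')) ((ι × ι') × (κ × κ')) ℂ)
    (N : Matrix (ι' × κ') (ι' × κ') ℂ) :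
    ptraceMul (c • M) N = c • ptraceMul M N := by
  ext p q
  simp [ptraceMul, Finset.mul_sum, mul_assoc]

lemma ptraceMul_sub_left [Fintype ι'] [Fintype κ']
    (M M' : Matrix ((ι × ι') × (κ × κ')) ((ι × ι') × (κ × κ')) ℂ)
    (N : Matrix (ι' × κ') (ι' × κ') ℂ) :
    ptraceMul (M - M') N = ptraceMul M N - ptraceMul M' N := by
  ext p q
  simp [ptraceMul, sub_mul, Finset.sum_sub_distrib]

lemma ptraceMul_sub_right [Fintype ι'] [Fintype κ']
    (M : Matrix ((ι × ι') × (κ × κ')) ((ι × ι') × (κ × κ')) ℂ)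
    (N N' : Matrix (ι' × κ') (ι' × κ') ℂ) :
    ptraceMul M (N - N') = ptraceMul M N - ptraceMul M N' := by
  ext p q
  simp [ptraceMul, mul_sub, Finset.sum_sub_distrib]

end Tensor

section Rate

/-- Properties of the fidelity `g n K` used to compare achievable rates. -/
structure IsFidelityFamily (g : ℕ → ℝ → ℝ) (C : ℝ) : Prop where
  anti : ∀ n K L, 0 < K → K ≤ L → g n L ≤ g n K
  le_one : ∀ n K, 0 < K → g n K ≤ 1
  eq_one : ∀ n K, 0 < K → K ≤ 1 → g n K = 1
  le_div : ∀ n K, 0 < K → g n K ≤ C ^ n / K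

/-- The rates achievable for a family of fidelities. -/
def rateSet (g : ℕ → ℝ → ℝ) : Set ℝ :=
  {r : ℝ | 0 ≤ r ∧
    Tendsto (fun n : ℕ => g n ((⌊(2 : ℝ) ^ (r * (n : ℝ))⌋ : ℤ) : ℝ)) atTop (nhds 1)}

lemma one_le_floor_two_rpow {r : ℝ} (hr : 0 ≤ r) (n : ℕ) :
    (1 : ℝ) ≤ ((⌊(2 : ℝ) ^ (r * (n : ℝ))⌋ : ℤ) : ℝ) := by
  have h : (1 : ℝ) ≤ (2 : ℝ) ^ (r * (n : ℝ)) :=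
    Real.one_le_rpow (by norm_num) (by positivity)
  exact_mod_cast Int.le_floor.mpr (by exact_mod_cast h)

lemma half_two_rpow_le_floor {r : ℝ} (hr : 0 ≤ r) (n : ℕ) :
    (2 : ℝ) ^ (r * (n : ℝ)) / 2 ≤ ((⌊(2 : ℝ) ^ (r * (n : ℝ))⌋ : ℤ) : ℝ) := by
  have h1 := one_le_floor_two_rpow hr n
  have h2 := Int.lt_floor_add_one ((2 : ℝ) ^ (r * (n : ℝ)))
  linarith

lemma eventually_two_rpow_le_floor {s r : ℝ} (hr : 0 ≤ r) (hsr : s < r) :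
    ∀ᶠ n : ℕ in atTop, (2 : ℝ) ^ (s * (n : ℝ)) ≤ ((⌊(2 : ℝ) ^ (r * (n : ℝ))⌋ : ℤ) : ℝ) := by
  obtain ⟨N, hN⟩ := exists_nat_ge (1 / (r - s))
  filter_upwards [eventually_ge_atTop N] with n hn
  refine le_trans ?_ (half_two_rpow_le_floor hr n)
  have hrs : 0 < r - s := sub_pos.mpr hsr
  have h1 : 1 ≤ (r - s) * n := by
    have : 1 / (r - s) ≤ n := hN.trans (by exact_mod_cast hn)
    rwa [div_le_iff₀' hrs] at this
  have h2 : (2 : ℝ) ^ (s * (n : ℝ)) ≤ (2 : ℝ) ^ (r * (n : ℝ) - 1) :=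
    Real.rpow_le_rpow_of_exponent_le (by norm_num) (by linarith)
  rwa [Real.rpow_sub_one (by norm_num)] at h2

variable {g : ℕ → ℝ → ℝ} {C : ℝ}

lemma IsFidelityFamily.tendsto_one_of_eventually_le (hg : IsFidelityFamily g C) {u v : ℕ → ℝ}
    (hu : Tendsto (fun n => g n (u n)) atTop (nhds 1)) (hv : ∀ n, 0 < v n)
    (hvu : ∀ᶠ n in atTop, v n ≤ u n) : Tendsto (fun n => g n (v n)) atTop (nhds 1) := by
  refine tendsto_of_tendsto_of_tendsto_of_le_of_le' hu tendsto_const_nhds ?_ ?_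
  · filter_upwards [hvu] with n hn using hg.anti n _ _ (hv n) hn
  · exact Eventually.of_forall fun n => hg.le_one n _ (hv n)

lemma IsFidelityFamily.zero_mem_rateSet (hg : IsFidelityFamily g C) : 0 ∈ rateSet g := by
  refine ⟨le_rfl, ?_⟩
  have : ∀ n, g n 1 = 1 := fun n => hg.eq_one n 1 one_pos le_rfl
  simp [this]

lemma IsFidelityFamily.le_logb_of_mem_rateSet (hg : IsFidelityFamily g C) (hC : 1 ≤ C) {r : ℝ}
    (hr : r ∈ rateSet g) : r ≤ Real.logb 2 C := by
  by_contra! hlt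
  have hC0 : 0 < C := by linarith
  have hCr : C < 2 ^ r := (Real.logb_lt_iff_lt_rpow (by norm_num) hC0).mp hlt
  have h2r : (0 : ℝ) < 2 ^ r := by positivity
  have h0 : Tendsto (fun n : ℕ => 2 * (C / 2 ^ r) ^ n) atTop (nhds (2 * 0)) :=
    (tendsto_pow_atTop_nhds_zero_of_lt_one (by positivity) ((div_lt_one h2r).mpr hCr)).const_mul 2
  have hle : (1 : ℝ) ≤ 2 * 0 := by
    refine le_of_tendsto_of_tendsto' hr.2 h0 fun n => ?_
    have hf := one_le_floor_two_rpow hr.1 n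
    refine (hg.le_div n _ (by linarith)).trans ?_
    have hh := half_two_rpow_le_floor hr.1 n
    have hp : (0 : ℝ) < 2 ^ (r * (n : ℝ)) := by positivity
    calc C ^ n / _ ≤ C ^ n / ((2 : ℝ) ^ (r * (n : ℝ)) / 2) := by gcongr
      _ = 2 * (C / 2 ^ r) ^ n := by
        rw [Real.rpow_mul (by norm_num), Real.rpow_natCast, div_pow]
        field_simp
  linarith

lemma IsFidelityFamily.sSup_rateSet_nonneg (hg : IsFidelityFamily g C) (hC : 1 ≤ C) :
    0 ≤ sSup (rateSet g) :=
  le_csSup ⟨_, fun _ => hg.le_logb_of_mem_rateSet hC⟩ hg.zero_mem_rateSet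

lemma IsFidelityFamily.sSup_rateSet_le (hg : IsFidelityFamily g C) (hC : 1 ≤ C) :
    sSup (rateSet g) ≤ Real.logb 2 C :=
  csSup_le ⟨0, hg.zero_mem_rateSet⟩ fun _ => hg.le_logb_of_mem_rateSet hC

/-- Rescaling the fidelities geometrically shifts the optimal rate. -/
lemma IsFidelityFamily.sSup_rateSet_rescale (hg : IsFidelityFamily g C) (hC : 1 ≤ C) {l : ℝ}
    (hl : 1 ≤ l) :
    sSup (rateSet fun n K => g n (K / l ^ n)) = sSup (rateSet g) + Real.logb 2 l := by
  have hl0 : 0 < l := by linarith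
  have hlog : 0 ≤ Real.logb 2 l := Real.logb_nonneg (by norm_num) hl
  have hpow (s : ℝ) (n : ℕ) :
      (2 : ℝ) ^ ((s + Real.logb 2 l) * (n : ℝ)) / l ^ n = 2 ^ (s * (n : ℝ)) := by
    rw [add_mul, Real.rpow_add (by norm_num), Real.rpow_mul (y := Real.logb 2 l) (by norm_num),
      Real.rpow_logb (by norm_num) (by norm_num) hl0, Real.rpow_natCast]
    field_simp
  have hbdd : BddAbove (rateSet g) := ⟨_, fun _ => hg.le_logb_of_mem_rateSet hC⟩
  have hupper : ∀ r ∈ rateSet (fun n K => g n (K / l ^ n)),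
      r ≤ sSup (rateSet g) + Real.logb 2 l := by
    intro r hr
    by_contra! hlt
    obtain ⟨s, hs1, hs2⟩ := exists_between (lt_sub_iff_add_lt.mpr hlt)
    have hs0 : 0 ≤ s := (hg.sSup_rateSet_nonneg hC).trans hs1.le
    have hmem : s ∈ rateSet g := by
      refine ⟨hs0, hg.tendsto_one_of_eventually_le hr.2
        (fun n => by linarith [one_le_floor_two_rpow hs0 n]) ?_⟩
      filter_upwards [eventually_two_rpow_le_floor hr.1 (lt_sub_iff_add_lt.mp hs2)] with n hn
      refine (Int.floor_le _).trans ?_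
      rw [← hpow]
      exact div_le_div_of_nonneg_right hn (by positivity)
    exact absurd (le_csSup hbdd hmem) (not_le.mpr hs1)
  have hfloor (s : ℝ) (n : ℕ) :
      ((⌊(2 : ℝ) ^ ((s + Real.logb 2 l) * (n : ℝ))⌋ : ℤ) : ℝ) / l ^ n ≤ 2 ^ (s * (n : ℝ)) :=
    (div_le_div_of_nonneg_right (Int.floor_le _) (pow_nonneg hl0.le n)).trans_eq (hpow s n)
  have hpos (s : ℝ) (hs : 0 ≤ s) (n : ℕ) :
      0 < ((⌊(2 : ℝ) ^ ((s + Real.logb 2 l) * (n : ℝ))⌋ : ℤ) : ℝ) / l ^ n :=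
    div_pos (by linarith [one_le_floor_two_rpow (add_nonneg hs hlog) n]) (by positivity)
  have hlog_mem : Real.logb 2 l ∈ rateSet (fun n K => g n (K / l ^ n)) := by
    refine ⟨hlog, ?_⟩
    have (n : ℕ) : g n (((⌊(2 : ℝ) ^ (Real.logb 2 l * (n : ℝ))⌋ : ℤ) : ℝ) / l ^ n) = 1 :=
      hg.eq_one n _ (by simpa using hpos 0 le_rfl n) (by simpa using hfloor 0 n)
    simp only [this]
    exact tendsto_const_nhds
  have hbdd' : BddAbove (rateSet fun n K => g n (K / l ^ n)) := ⟨_, hupper⟩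
  refine le_antisymm (csSup_le ⟨_, hlog_mem⟩ hupper) ?_
  rw [← le_sub_iff_add_le]
  refine csSup_le ⟨0, hg.zero_mem_rateSet⟩ fun r hr => le_of_forall_lt fun s hs => ?_
  obtain ⟨t, hst, htr⟩ := exists_between hs
  refine hst.trans_le (le_sub_iff_add_le.mpr ?_)
  rcases lt_or_ge t 0 with ht | ht
  · exact (by linarith : t + Real.logb 2 l ≤ Real.logb 2 l).trans (le_csSup hbdd' hlog_mem)
  · refine le_csSup hbdd' ⟨add_nonneg ht hlog, ?_⟩
    refine hg.tendsto_one_of_eventually_le hr.2 (hpos t ht) ?_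
    filter_upwards [eventually_two_rpow_le_floor hr.1 htr] with n hn
    exact (hfloor t n).trans hn

end Rate

section Fidelity

variable {ι κ ι' κ' : Type*} [Fintype ι] [Fintype κ] [DecidableEq ι] [DecidableEq κ]
  [Fintype ι'] [Fintype κ'] [DecidableEq ι'] [DecidableEq κ']

/-- The constraints on the operator `F` in the fidelity of `K`-state p.p.t. distillation. -/
structure IsPPTTest (K : ℝ) (F : Matrix (ι × κ) (ι × κ) ℂ) : Prop where
  nonneg : F.PosSemidef
  le_one : (1 - F).PosSemidef
  ptrans_le : (((1 / K : ℝ) : ℂ) • 1 - ptrans F).PosSemidef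
  le_ptrans : (ptrans F + ((1 / K : ℝ) : ℂ) • 1).PosSemidef

lemma FGamma_eq_sSup (ρ : Matrix (ι × κ) (ι × κ) ℂ) (K : ℝ) :
    FGamma ρ K = sSup {x : ℝ | ∃ F, IsPPTTest K F ∧ x = ((F * ρ).trace).re} := by
  unfold FGamma
  congr 1
  ext x
  exact exists_congr fun F => ⟨fun ⟨h1, h2, h3, h4, h5⟩ => ⟨⟨h1, h2, h3, h4⟩, h5⟩,
    fun ⟨⟨h1, h2, h3, h4⟩, h5⟩ => ⟨h1, h2, h3, h4, h5⟩⟩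

lemma FGamma_congr {ρ : Matrix (ι × κ) (ι × κ) ℂ} {σ : Matrix (ι' × κ') (ι' × κ') ℂ} {K L : ℝ}
    (h : ∀ F, IsPPTTest K F → ∃ G, IsPPTTest L G ∧ (G * σ).trace = (F * ρ).trace)
    (h' : ∀ G, IsPPTTest L G → ∃ F, IsPPTTest K F ∧ (F * ρ).trace = (G * σ).trace) :
    FGamma ρ K = FGamma σ L := by
  rw [FGamma_eq_sSup, FGamma_eq_sSup]
  congr 1
  ext x
  constructor
  · rintro ⟨F, hF, rfl⟩
    obtain ⟨G, hG, e⟩ := h F hF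
    exact ⟨G, hG, by rw [e]⟩
  · rintro ⟨G, hG, rfl⟩
    obtain ⟨F, hF, e⟩ := h' G hG
    exact ⟨F, hF, by rw [e]⟩

omit [Fintype ι] [Fintype κ] [Fintype ι'] [Fintype κ'] in
lemma IsPPTTest.submatrix {K : ℝ} {F : Matrix (ι × κ) (ι × κ) ℂ} (hF : IsPPTTest K F)
    (e : ι' ≃ ι) (f : κ' ≃ κ) :
    IsPPTTest K (F.submatrix (Prod.map e f) (Prod.map e f)) := by
  have h1 : (1 : Matrix (ι × κ) (ι × κ) ℂ).submatrix (Prod.map e f) (Prod.map e f) = 1 :=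
    submatrix_one _ (e.injective.prodMap f.injective)
  have hp : ptrans (F.submatrix (Prod.map e f) (Prod.map e f)) =
      (ptrans F).submatrix (Prod.map e f) (Prod.map e f) := rfl
  refine ⟨hF.nonneg.submatrix _, ?_, ?_, ?_⟩
  · rw [← h1]
    exact hF.le_one.submatrix _
  · rw [← h1, hp]
    exact hF.ptrans_le.submatrix _
  · rw [← h1, hp]
    exact hF.le_ptrans.submatrix _

lemma FGamma_submatrix (ρ : Matrix (ι × κ) (ι × κ) ℂ) (e : ι' ≃ ι) (f : κ' ≃ κ) (K : ℝ) :
    FGamma (ρ.submatrix (Prod.map e f) (Prod.map e f)) K = FGamma ρ K := by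
  have htr (M : Matrix (ι × κ) (ι × κ) ℂ) :
      (M.submatrix (Prod.map e f) (Prod.map e f)).trace = M.trace :=
    (e.prodCongr f).sum_comp fun x => M x x
  have hmul (M N : Matrix (ι × κ) (ι × κ) ℂ) :
      M.submatrix (Prod.map e f) (Prod.map e f) * N.submatrix (Prod.map e f) (Prod.map e f) =
        (M * N).submatrix (Prod.map e f) (Prod.map e f) :=
    submatrix_mul_equiv M N (Prod.map e f) (e.prodCongr f) (Prod.map e f)
  refine FGamma_congr (fun F hF => ?_) fun G hG => ?_
  · refine ⟨_, hF.submatrix e.symm f.symm, ?_⟩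
    have hF' : (F.submatrix (Prod.map e.symm f.symm) (Prod.map e.symm f.symm)).submatrix
        (Prod.map e f) (Prod.map e f) = F := by
      ext x y
      simp [Prod.map]
    rw [← htr, ← hmul, hF']
  · exact ⟨_, hG.submatrix e f, by rw [hmul, htr]⟩

lemma Matrix.PosSemidef.trace_mul_nonneg {n : Type*} [Fintype n] [DecidableEq n]
    {A B : Matrix n n ℂ}
    (hA : A.PosSemidef) (hB : B.PosSemidef) : 0 ≤ ((A * B).trace).re := by
  have h := (hA.kronecker hB.transpose).submatrix (fun i : n => (i, i))
  have h' := h.dotProduct_mulVec_nonneg 1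
  have : star (1 : n → ℂ) ⬝ᵥ (((kroneckerMap (· * ·) A Bᵀ).submatrix (fun i : n => (i, i))
      (fun i : n => (i, i))) *ᵥ 1) = (A * B).trace := by
    simp [dotProduct, mulVec, trace, Matrix.mul_apply]
  rw [this] at h'
  exact (Complex.le_def.mp h').1

lemma Matrix.PosSemidef.le_trace {n : Type*} [Fintype n] [DecidableEq n] {A : Matrix n n ℂ}
    (hA : A.PosSemidef) : (A.trace • 1 - A).PosSemidef := by
  have hs := hA.isHermitian.spectral_theorem
  set U := hA.isHermitian.eigenvectorUnitary
  have htr := hA.isHermitian.trace_eq_sum_eigenvalues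
  have hd : (diagonal (fun i => A.trace - (hA.isHermitian.eigenvalues i : ℂ))).PosSemidef := by
    refine PosSemidef.diagonal fun i => ?_
    rw [htr, Pi.zero_apply, sub_nonneg]
    exact (Complex.real_le_real.mpr (Finset.single_le_sum (f := hA.isHermitian.eigenvalues)
      (fun j _ => hA.eigenvalues_nonneg j) (Finset.mem_univ i))).trans_eq (by simp)
  have hU : (U : Matrix n n ℂ) * star (U : Matrix n n ℂ) = 1 := Unitary.mul_star_self_of_mem U.2
  have h := hd.mul_mul_conjTranspose_same (U : Matrix n n ℂ)
  have he : A.trace • 1 - A = (U : Matrix n n ℂ) *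
      diagonal (fun i => A.trace - (hA.isHermitian.eigenvalues i : ℂ)) *
        (U : Matrix n n ℂ)ᴴ := by
    have : diagonal (fun i => A.trace - (hA.isHermitian.eigenvalues i : ℂ)) =
        A.trace • 1 - diagonal (RCLike.ofReal ∘ hA.isHermitian.eigenvalues) := by
      ext i j
      by_cases hij : i = j <;> simp [hij]
    rw [Unitary.conjStarAlgAut_apply] at hs
    rw [this, mul_sub, sub_mul, ← star_eq_conjTranspose, ← hs, Matrix.mul_smul, Matrix.smul_mul,
      mul_one, hU]
  rw [he]
  exact h

omit [Fintype ι] [Fintype κ] in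
lemma IsPPTTest.zero {K : ℝ} (hK : 0 < K) : IsPPTTest K (0 : Matrix (ι × κ) (ι × κ) ℂ) := by
  have h1 : (((1 / K : ℝ) : ℂ) • (1 : Matrix (ι × κ) (ι × κ) ℂ)).PosSemidef :=
    PosSemidef.one.smul (Complex.zero_le_real.mpr (by positivity))
  have h0 : ptrans (0 : Matrix (ι × κ) (ι × κ) ℂ) = 0 := rfl
  refine ⟨PosSemidef.zero, ?_, ?_, ?_⟩
  · simpa using PosSemidef.one
  · simpa only [h0, sub_zero] using h1
  · simpa only [h0, zero_add] using h1

omit [Fintype ι] [Fintype κ] in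
lemma ptrans_one : ptrans (1 : Matrix (ι × κ) (ι × κ) ℂ) = 1 := by
  ext x y
  simp only [ptrans, one_apply, Prod.ext_iff]
  congr 1
  simp [eq_comm]

omit [Fintype ι] [Fintype κ] in
lemma IsPPTTest.smul_one {K c : ℝ} (hc : 0 ≤ c) (hc1 : c ≤ 1) (hcK : c ≤ 1 / K) :
    IsPPTTest K ((c : ℂ) • (1 : Matrix (ι × κ) (ι × κ) ℂ)) := by
  have hp : ptrans ((c : ℂ) • (1 : Matrix (ι × κ) (ι × κ) ℂ)) = (c : ℂ) • ptrans 1 := rfl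
  have h (r : ℝ) (hr : 0 ≤ r) : ((r : ℂ) • (1 : Matrix (ι × κ) (ι × κ) ℂ)).PosSemidef :=
    PosSemidef.one.smul (Complex.zero_le_real.mpr hr)
  refine ⟨h c hc, ?_, ?_, ?_⟩
  · convert h (1 - c) (by linarith) using 1
    push_cast
    module
  · rw [hp, ptrans_one]
    convert h (1 / K - c) (by linarith) using 1
    push_cast
    module
  · rw [hp, ptrans_one]
    convert h (1 / K + c) (by linarith) using 1
    push_cast
    module

omit [Fintype ι] [Fintype κ] in
lemma IsPPTTest.anti {K L : ℝ} (hK : 0 < K) (hKL : K ≤ L) {F : Matrix (ι × κ) (ι × κ) ℂ}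
    (hF : IsPPTTest L F) : IsPPTTest K F := by
  have h : (((1 / K - 1 / L : ℝ) : ℂ) • (1 : Matrix (ι × κ) (ι × κ) ℂ)).PosSemidef :=
    PosSemidef.one.smul (Complex.zero_le_real.mpr
      (sub_nonneg.mpr (one_div_le_one_div_of_le hK hKL)))
  refine ⟨hF.nonneg, hF.le_one, ?_, ?_⟩
  · convert hF.ptrans_le.add h using 1
    push_cast
    module
  · convert hF.le_ptrans.add h using 1
    push_cast
    module

variable {ρ : Matrix (ι × κ) (ι × κ) ℂ} {K L : ℝ}

lemma IsPPTTest.trace_mul_le_one (hρ : ρ.PosSemidef) (hρ1 : ρ.trace = 1)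
    {F : Matrix (ι × κ) (ι × κ) ℂ} (hF : IsPPTTest K F) : ((F * ρ).trace).re ≤ 1 := by
  have h := hF.le_one.trace_mul_nonneg hρ
  rw [sub_mul, one_mul, trace_sub, hρ1] at h
  simpa using h

omit [DecidableEq ι] [DecidableEq κ] in
lemma trace_ptrans (F : Matrix (ι × κ) (ι × κ) ℂ) : (ptrans F).trace = F.trace := rfl

lemma IsPPTTest.trace_mul_le_div (hρ : ρ.PosSemidef) (hρ1 : ρ.trace = 1)
    {F : Matrix (ι × κ) (ι × κ) ℂ} (hF : IsPPTTest K F) :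
    ((F * ρ).trace).re ≤ (Fintype.card ι * Fintype.card κ : ℕ) / K := by
  have h := hF.nonneg.trace_mul_nonneg hρ.le_trace
  rw [hρ1, one_smul, mul_sub, mul_one, trace_sub, Complex.sub_re] at h
  have h' := (Complex.le_def.mp hF.ptrans_le.trace_nonneg).1
  rw [trace_sub, trace_smul, trace_ptrans, trace_one, Fintype.card_prod, Complex.sub_re] at h'
  have he : (((1 / K : ℝ) : ℂ) • ((Fintype.card ι * Fintype.card κ : ℕ) : ℂ)).re =
      (Fintype.card ι * Fintype.card κ : ℕ) / K := by
    rw [smul_eq_mul, Complex.re_ofReal_mul, Complex.natCast_re]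
    ring
  rw [he, Complex.zero_re] at h'
  linarith

lemma bddAbove_testValues (hρ : ρ.PosSemidef) (hρ1 : ρ.trace = 1) (K : ℝ) :
    BddAbove {x : ℝ | ∃ F, IsPPTTest K F ∧ x = ((F * ρ).trace).re} :=
  ⟨1, by
    rintro _ ⟨F, hF, rfl⟩
    exact hF.trace_mul_le_one hρ hρ1⟩

lemma nonempty_testValues (ρ : Matrix (ι × κ) (ι × κ) ℂ) (hK : 0 < K) :
    {x : ℝ | ∃ F, IsPPTTest K F ∧ x = ((F * ρ).trace).re}.Nonempty :=
  ⟨_, 0, IsPPTTest.zero hK, rfl⟩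

lemma FGamma_anti (hρ : ρ.PosSemidef) (hρ1 : ρ.trace = 1) (hK : 0 < K) (hKL : K ≤ L) :
    FGamma ρ L ≤ FGamma ρ K := by
  rw [FGamma_eq_sSup, FGamma_eq_sSup]
  refine csSup_le_csSup (bddAbove_testValues hρ hρ1 K)
    (nonempty_testValues ρ (hK.trans_le hKL)) ?_
  rintro _ ⟨F, hF, rfl⟩
  exact ⟨F, hF.anti hK hKL, rfl⟩

lemma FGamma_le_one (hρ : ρ.PosSemidef) (hρ1 : ρ.trace = 1) (hK : 0 < K) : FGamma ρ K ≤ 1 := by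
  rw [FGamma_eq_sSup]
  refine csSup_le (nonempty_testValues ρ hK) ?_
  rintro _ ⟨F, hF, rfl⟩
  exact hF.trace_mul_le_one hρ hρ1

lemma FGamma_le_div (hρ : ρ.PosSemidef) (hρ1 : ρ.trace = 1) (hK : 0 < K) :
    FGamma ρ K ≤ (Fintype.card ι * Fintype.card κ : ℕ) / K := by
  rw [FGamma_eq_sSup]
  refine csSup_le (nonempty_testValues ρ hK) ?_
  rintro _ ⟨F, hF, rfl⟩
  exact hF.trace_mul_le_div hρ hρ1

lemma le_FGamma (hρ : ρ.PosSemidef) (hρ1 : ρ.trace = 1) {c : ℝ} (hc : 0 ≤ c) (hc1 : c ≤ 1)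
    (hcK : c ≤ 1 / K) : c ≤ FGamma ρ K := by
  rw [FGamma_eq_sSup]
  refine le_csSup (bddAbove_testValues hρ hρ1 K) ⟨_, IsPPTTest.smul_one hc hc1 hcK, ?_⟩
  simp [hρ1]

lemma FGamma_eq_one (hρ : ρ.PosSemidef) (hρ1 : ρ.trace = 1) (hK : 0 < K) (hK1 : K ≤ 1) :
    FGamma ρ K = 1 :=
  le_antisymm (FGamma_le_one hρ hρ1 hK)
    (le_FGamma hρ hρ1 zero_le_one le_rfl (by rwa [le_div_iff₀ hK, one_mul]))

end Fidelity

section TensorPower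

variable {ι κ : Type*} [Fintype ι] [Fintype κ] [DecidableEq ι] [DecidableEq κ]

omit [Fintype ι] [Fintype κ] [DecidableEq ι] [DecidableEq κ] in
lemma tpow_succ (ρ : Matrix (ι × κ) (ι × κ) ℂ) (n : ℕ) :
    tpow ρ (n + 1) = (tensorBip (tpow ρ n) ρ).submatrix
      (Prod.map (((Fin.snocEquiv fun _ => ι).symm.trans (Equiv.prodComm _ _)))
        (((Fin.snocEquiv fun _ => κ).symm.trans (Equiv.prodComm _ _))))
      (Prod.map (((Fin.snocEquiv fun _ => ι).symm.trans (Equiv.prodComm _ _)))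
        (((Fin.snocEquiv fun _ => κ).symm.trans (Equiv.prodComm _ _)))) := by
  ext x y
  exact Fin.prod_univ_castSucc fun i => ρ (x.1 i, x.2 i) (y.1 i, y.2 i)

omit [Fintype ι] [Fintype κ] in
lemma tpow_zero (ρ : Matrix (ι × κ) (ι × κ) ℂ) : tpow ρ 0 = 1 := by
  ext x y
  obtain rfl : x = y := Subsingleton.elim _ _
  simp [tpow]

lemma Matrix.PosSemidef.tpow {ρ : Matrix (ι × κ) (ι × κ) ℂ} (hρ : ρ.PosSemidef) (n : ℕ) :
    (tpow ρ n).PosSemidef := by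
  induction n with
  | zero =>
    rw [tpow_zero]
    exact PosSemidef.one
  | succ n ih =>
    rw [tpow_succ]
    exact (ih.tensorBip hρ).submatrix _

lemma trace_tpow (ρ : Matrix (ι × κ) (ι × κ) ℂ) (n : ℕ) : (tpow ρ n).trace = ρ.trace ^ n := by
  induction n with
  | zero => simp [tpow_zero]
  | succ n ih =>
    rw [pow_succ, ← ih, ← trace_tensorBip, tpow_succ]
    exact (Equiv.prodCongr ((Fin.snocEquiv fun _ => ι).symm.trans (Equiv.prodComm _ _))
      ((Fin.snocEquiv fun _ => κ).symm.trans (Equiv.prodComm _ _))).sum_comp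
      fun x => tensorBip (_root_.tpow ρ n) ρ x x

lemma isFidelityFamily_FGamma_tpow {ρ : Matrix (ι × κ) (ι × κ) ℂ} (hρ : ρ.PosSemidef)
    (hρ1 : ρ.trace = 1) :
    IsFidelityFamily (fun n K => FGamma (tpow ρ n) K)
      (Fintype.card ι * Fintype.card κ : ℕ) where
  anti n _ _ := FGamma_anti (hρ.tpow n) (by rw [trace_tpow, hρ1, one_pow])
  le_one n _ := FGamma_le_one (hρ.tpow n) (by rw [trace_tpow, hρ1, one_pow])
  eq_one n _ := FGamma_eq_one (hρ.tpow n) (by rw [trace_tpow, hρ1, one_pow])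
  le_div n K hK := by
    refine (FGamma_le_div (hρ.tpow n) (by rw [trace_tpow, hρ1, one_pow]) hK).trans_eq ?_
    simp [mul_pow]

end TensorPower

section Werner

/-- The swap operator on `ℂ^d ⊗ ℂ^d`. -/
def swapOp (d : ℕ) : Matrix (Fin d × Fin d) (Fin d × Fin d) ℂ :=
  (d : ℂ) • ptrans (maxEnt d)

lemma swapOp_apply {d : ℕ} (hd : 0 < d) (x y : Fin d × Fin d) :
    swapOp d x y = if x = y.swap then 1 else 0 := by
  have : (d : ℂ) ≠ 0 := by exact_mod_cast hd.ne'
  simp [swapOp, ptrans, maxEnt, Prod.ext_iff, this, eq_comm]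

lemma swapOp_mul_self {d : ℕ} (hd : 0 < d) : swapOp d * swapOp d = 1 := by
  ext x y
  rw [Matrix.mul_apply, Finset.sum_eq_single x.swap]
  · simp [swapOp_apply hd, Matrix.one_apply, Prod.swap_inj]
  · intro z _ hz
    have : x ≠ z.swap := fun h => hz (by simp [h])
    simp [swapOp_apply hd, this]
  · simp

lemma swapOp_conjTranspose {d : ℕ} (hd : 0 < d) : (swapOp d)ᴴ = swapOp d := by
  ext x y
  rw [conjTranspose_apply, swapOp_apply hd, swapOp_apply hd]
  have : y = x.swap ↔ x = y.swap := ⟨fun h => by simp [h], fun h => by simp [h]⟩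
  simp [this, apply_ite star]

lemma trace_swapOp {d : ℕ} (hd : 0 < d) : (swapOp d).trace = d := by
  simp only [trace, diag_apply, swapOp_apply hd, Fintype.sum_prod_type, Prod.swap_prod_mk,
    Prod.mk.injEq]
  simp [eq_comm]

lemma maxEnt_mul_self {d : ℕ} (hd : 0 < d) : maxEnt d * maxEnt d = maxEnt d := by
  have hd' : (d : ℂ) ≠ 0 := by exact_mod_cast hd.ne'
  ext x y
  simp only [Matrix.mul_apply, maxEnt, Fintype.sum_prod_type]
  by_cases hx : x.1 = x.2 <;> by_cases hy : y.1 = y.2 <;> simp [hx, hy, hd']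

lemma maxEnt_conjTranspose (d : ℕ) : (maxEnt d)ᴴ = maxEnt d := by
  ext x y
  simp [maxEnt, apply_ite star, and_comm]

lemma trace_maxEnt {d : ℕ} (hd : 0 < d) : (maxEnt d).trace = 1 := by
  have hd' : (d : ℂ) ≠ 0 := by exact_mod_cast hd.ne'
  simp [trace, maxEnt, Fintype.sum_prod_type, hd']

lemma posSemidef_maxEnt {d : ℕ} (hd : 0 < d) : (maxEnt d).PosSemidef := by
  have h := posSemidef_conjTranspose_mul_self (maxEnt d)
  rwa [maxEnt_conjTranspose, maxEnt_mul_self hd] at h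

lemma posSemidef_one_sub_maxEnt {d : ℕ} (hd : 0 < d) : (1 - maxEnt d).PosSemidef := by
  have h := posSemidef_conjTranspose_mul_self (1 - maxEnt d)
  rw [conjTranspose_sub, conjTranspose_one, maxEnt_conjTranspose] at h
  convert h using 1
  simp [mul_sub, sub_mul, maxEnt_mul_self hd]

lemma posSemidef_one_sub_swapOp {d : ℕ} (hd : 0 < d) : (1 - swapOp d).PosSemidef := by
  have h := (posSemidef_conjTranspose_mul_self (1 - swapOp d)).smul
    (Complex.zero_le_real.mpr (by norm_num : (0 : ℝ) ≤ 1 / 2))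
  rw [conjTranspose_sub, conjTranspose_one, swapOp_conjTranspose hd] at h
  convert h using 1
  simp only [mul_sub, sub_mul, swapOp_mul_self hd, mul_one, one_mul]
  push_cast
  module

lemma posSemidef_one_add_swapOp {d : ℕ} (hd : 0 < d) : (1 + swapOp d).PosSemidef := by
  have h := (posSemidef_conjTranspose_mul_self (1 + swapOp d)).smul
    (Complex.zero_le_real.mpr (by norm_num : (0 : ℝ) ≤ 1 / 2))
  rw [conjTranspose_add, conjTranspose_one, swapOp_conjTranspose hd] at h
  convert h using 1
  simp only [mul_add, add_mul, swapOp_mul_self hd, mul_one, one_mul]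
  push_cast
  module

lemma werner_one (d : ℕ) :
    werner d 1 = ((1 / ((d : ℝ) ^ 2 - d) : ℝ) : ℂ) • (1 - swapOp d) := by
  simp [werner, swapOp]

variable {d : ℕ}

lemma sq_sub_self_pos (hd : 2 ≤ d) : (0 : ℝ) < (d : ℝ) ^ 2 - d := by
  have : (2 : ℝ) ≤ d := by exact_mod_cast hd
  nlinarith

lemma sq_sub_self_ne_zero (hd : 2 ≤ d) : (d : ℂ) ^ 2 - d ≠ 0 := by
  exact_mod_cast (sq_sub_self_pos hd).ne'

lemma natCast_sub_one_ne_zero (hd : 2 ≤ d) : (d : ℂ) - 1 ≠ 0 :=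
  sub_ne_zero.mpr (by exact_mod_cast (by lia : d ≠ 1))

lemma posSemidef_werner_one (hd : 2 ≤ d) : (werner d 1).PosSemidef := by
  rw [werner_one]
  exact (posSemidef_one_sub_swapOp (by lia)).smul
    (Complex.zero_le_real.mpr (one_div_nonneg.mpr (sq_sub_self_pos hd).le))

lemma trace_werner_one (hd : 2 ≤ d) : (werner d 1).trace = 1 := by
  rw [werner_one, trace_smul, trace_sub, trace_swapOp (by lia), trace_one]
  have := sq_sub_self_ne_zero hd
  simp only [Fintype.card_prod, Fintype.card_fin, smul_eq_mul]
  have h := natCast_sub_one_ne_zero hd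
  push_cast
  field_simp

lemma ptrans_werner_one (hd : 2 ≤ d) :
    ptrans (werner d 1) = ((1 / ((d : ℝ) ^ 2 - d) : ℝ) : ℂ) • (1 - maxEnt d) -
      ((1 / (d : ℝ) : ℝ) : ℂ) • maxEnt d := by
  have h : ptrans (werner d 1) =
      ((1 / ((d : ℝ) ^ 2 - d) : ℝ) : ℂ) • (ptrans 1 - (d : ℂ) • maxEnt d) := by
    rw [werner_one]
    rfl
  have h1 := natCast_sub_one_ne_zero hd
  have h2 : (d : ℂ) ≠ 0 := by exact_mod_cast (by lia : d ≠ 0)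
  have h3 : (d : ℂ) ^ 2 - d = d * (d - 1) := by ring
  rw [h, ptrans_one]
  push_cast
  rw [h3]
  match_scalars <;> field_simp
  ring

/-- The test operator on the Werner factor used to extend a test on the other factor. -/
def wernerTest (d : ℕ) : Matrix (Fin d × Fin d) (Fin d × Fin d) ℂ :=
  (((d : ℝ) / (d + 2) : ℝ) : ℂ) • (1 - ((2 / d : ℝ) : ℂ) • swapOp d)

lemma natCast_add_two_ne_zero (d : ℕ) : (d : ℂ) + 2 ≠ 0 := by
  exact_mod_cast (by lia : d + 2 ≠ 0)

lemma posSemidef_wernerTest (hd : 2 ≤ d) : (wernerTest d).PosSemidef := by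
  have h2 : (2 : ℝ) ≤ d := by exact_mod_cast hd
  have hA := (posSemidef_one_sub_swapOp (by lia : 0 < d)).smul
    (Complex.zero_le_real.mpr (by positivity : (0 : ℝ) ≤ 2 / (d + 2)))
  have hB := (PosSemidef.one (n := Fin d × Fin d) (R := ℂ)).smul
    (Complex.zero_le_real.mpr
      (div_nonneg (by linarith) (by linarith) : (0 : ℝ) ≤ (d - 2) / (d + 2)))
  convert hA.add hB using 1
  have h3 : (d : ℂ) ≠ 0 := by exact_mod_cast (by lia : d ≠ 0)
  have h4 := natCast_add_two_ne_zero d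
  rw [wernerTest]
  push_cast
  match_scalars <;> field_simp
  ring

lemma posSemidef_one_sub_wernerTest (hd : 2 ≤ d) : (1 - wernerTest d).PosSemidef := by
  have hA := (posSemidef_one_add_swapOp (by lia : 0 < d)).smul
    (Complex.zero_le_real.mpr (by positivity : (0 : ℝ) ≤ 2 / (d + 2)))
  convert hA using 1
  have h3 : (d : ℂ) ≠ 0 := by exact_mod_cast (by lia : d ≠ 0)
  have h4 := natCast_add_two_ne_zero d
  rw [wernerTest]
  push_cast
  match_scalars <;> field_simp
  ring

lemma wernerTest_mul_werner_one (hd : 2 ≤ d) : wernerTest d * werner d 1 = werner d 1 := by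
  have h3 : (d : ℂ) ≠ 0 := by exact_mod_cast (by lia : d ≠ 0)
  have h4 := natCast_add_two_ne_zero d
  rw [wernerTest, werner_one, Matrix.mul_smul, Matrix.smul_mul, mul_sub, sub_mul, sub_mul,
    Matrix.smul_mul, Matrix.smul_mul, swapOp_mul_self (by lia)]
  congr 1
  simp only [mul_one, one_mul]
  push_cast
  match_scalars <;> field_simp <;> ring

lemma ptrans_wernerTest (hd : 2 ≤ d) :
    ptrans (wernerTest d) = (((d : ℝ) / (d + 2) : ℝ) : ℂ) • ((1 - maxEnt d) - maxEnt d) := by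
  have h : ptrans (wernerTest d) = (((d : ℝ) / (d + 2) : ℝ) : ℂ) •
      (ptrans 1 - ((2 / d : ℝ) : ℂ) • (d : ℂ) • maxEnt d) := rfl
  have h3 : (d : ℂ) ≠ 0 := by exact_mod_cast (by lia : d ≠ 0)
  rw [h, ptrans_one]
  push_cast
  congr 1
  match_scalars <;> field_simp
  ring

variable {ι κ : Type*} [Fintype ι] [Fintype κ] [DecidableEq ι] [DecidableEq κ]

/-- If `|G| ≤ k`, then the partial trace of `G` against `N₁ - N₂` is at most `k Tr(N₁ + N₂)`. -/
lemma posSemidef_sub_ptraceMul_sub {ι' κ' : Type*} [Fintype ι'] [Fintype κ'] [DecidableEq ι']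
    [DecidableEq κ'] {G : Matrix ((ι × ι') × (κ × κ')) ((ι × ι') × (κ × κ')) ℂ} {k : ℂ}
    {N₁ N₂ : Matrix (ι' × κ') (ι' × κ') ℂ} (h₁ : N₁.PosSemidef) (h₂ : N₂.PosSemidef)
    (hG : (k • 1 - G).PosSemidef) (hG' : (G + k • 1).PosSemidef) :
    ((k * (N₁.trace + N₂.trace)) • 1 - ptraceMul G (N₁ - N₂)).PosSemidef ∧
      (ptraceMul G (N₁ - N₂) + (k * (N₁.trace + N₂.trace)) • 1).PosSemidef := by
  constructor
  · convert (hG.ptraceMul h₁).add (hG'.ptraceMul h₂) using 1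
    rw [ptraceMul_sub_right, ptraceMul_sub_left, ptraceMul_add_left, ptraceMul_smul_left,
      ptraceMul_smul_left, ptraceMul_one, ptraceMul_one]
    module
  · convert (hG'.ptraceMul h₁).add (hG.ptraceMul h₂) using 1
    rw [ptraceMul_sub_right, ptraceMul_sub_left, ptraceMul_add_left, ptraceMul_smul_left,
      ptraceMul_smul_left, ptraceMul_one, ptraceMul_one]
    module

lemma IsPPTTest.ptraceMul_werner_one (hd : 2 ≤ d) {K : ℝ}
    {F : Matrix ((ι × Fin d) × (κ × Fin d)) ((ι × Fin d) × (κ × Fin d)) ℂ}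
    (hF : IsPPTTest K F) : IsPPTTest ((d : ℝ) * K / (d + 2)) (ptraceMul F (werner d 1)) := by
  have hW := posSemidef_werner_one hd
  have hd0 : 0 < d := by lia
  have h2 : (d : ℂ) ≠ 0 := by exact_mod_cast (by lia : d ≠ 0)
  have hP := (posSemidef_one_sub_maxEnt hd0).smul
    (Complex.zero_le_real.mpr (one_div_nonneg.mpr (sq_sub_self_pos hd).le))
  have hΦ := (posSemidef_maxEnt hd0).smul
    (Complex.zero_le_real.mpr (by positivity : (0 : ℝ) ≤ 1 / (d : ℝ)))
  have hmain := posSemidef_sub_ptraceMul_sub hP hΦ hF.ptrans_le hF.le_ptrans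
  have hk : ((1 / ((d : ℝ) * K / (d + 2)) : ℝ) : ℂ) = ((1 / K : ℝ) : ℂ) *
      ((((1 / ((d : ℝ) ^ 2 - d) : ℝ) : ℂ) • (1 - maxEnt d)).trace +
        (((1 / (d : ℝ) : ℝ) : ℂ) • maxEnt d).trace) := by
    rw [trace_smul, trace_smul, trace_sub, trace_maxEnt hd0, trace_one]
    simp only [Fintype.card_prod, Fintype.card_fin, smul_eq_mul]
    have h5 := natCast_sub_one_ne_zero hd
    have h6 : (d : ℂ) ^ 2 - d = d * (d - 1) := by ring
    push_cast
    rw [h6, one_div_div, div_mul_eq_div_div, div_eq_mul_one_div _ (K : ℂ), mul_comm]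
    congr 1
    field_simp
    ring
  rw [← hk, ← ptrans_werner_one hd, ← ptrans_ptraceMul] at hmain
  refine ⟨hF.nonneg.ptraceMul hW, ?_, hmain.1, hmain.2⟩
  have h := hF.le_one.ptraceMul hW
  rwa [ptraceMul_sub_left, ptraceMul_one, trace_werner_one hd, one_smul] at h

lemma IsPPTTest.tensorBip_wernerTest (hd : 2 ≤ d) {K : ℝ} {G : Matrix (ι × κ) (ι × κ) ℂ}
    (hG : IsPPTTest ((d : ℝ) * K / (d + 2)) G) : IsPPTTest K (tensorBip G (wernerTest d)) := by
  have hd0 : 0 < d := by lia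
  have hm : (0 : ℝ) ≤ (d : ℝ) / (d + 2) := by positivity
  have h3 : (d : ℂ) ≠ 0 := by exact_mod_cast (by lia : d ≠ 0)
  have h4 := natCast_add_two_ne_zero d
  have hk : (((d : ℝ) / (d + 2) : ℝ) : ℂ) * ((1 / ((d : ℝ) * K / (d + 2)) : ℝ) : ℂ) =
      ((1 / K : ℝ) : ℂ) := by
    push_cast
    rw [one_div_div, div_mul_eq_div_div, div_eq_mul_one_div _ (K : ℂ)]
    field_simp
  have hΦ := posSemidef_maxEnt hd0
  have hP := posSemidef_one_sub_maxEnt hd0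
  refine ⟨hG.nonneg.tensorBip (posSemidef_wernerTest hd), ?_, ?_, ?_⟩
  · convert (hG.le_one.tensorBip (posSemidef_wernerTest hd)).add
      ((PosSemidef.one (n := ι × κ) (R := ℂ)).tensorBip (posSemidef_one_sub_wernerTest hd)) using 1
    rw [← tensorBip_one_one]
    ext x y
    simp only [tensorBip, Matrix.sub_apply, Matrix.add_apply]
    ring
  · convert ((hG.ptrans_le.tensorBip hP).add (hG.le_ptrans.tensorBip hΦ)).smul
      (Complex.zero_le_real.mpr hm) using 1
    rw [ptrans_tensorBip, ptrans_wernerTest hd, ← hk, ← tensorBip_one_one]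
    ext x y
    simp only [tensorBip, Matrix.sub_apply, Matrix.add_apply, Matrix.smul_apply, smul_eq_mul]
    ring
  · convert ((hG.le_ptrans.tensorBip hP).add (hG.ptrans_le.tensorBip hΦ)).smul
      (Complex.zero_le_real.mpr hm) using 1
    rw [ptrans_tensorBip, ptrans_wernerTest hd, ← hk, ← tensorBip_one_one]
    ext x y
    simp only [tensorBip, Matrix.sub_apply, Matrix.add_apply, Matrix.smul_apply, smul_eq_mul]
    ring

lemma FGamma_tensorBip_werner_one (hd : 2 ≤ d) (ρ : Matrix (ι × κ) (ι × κ) ℂ) (K : ℝ) :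
    FGamma (tensorBip ρ (werner d 1)) K = FGamma ρ ((d : ℝ) * K / (d + 2)) := by
  refine FGamma_congr (fun F hF => ?_) fun G hG => ?_
  · exact ⟨_, hF.ptraceMul_werner_one hd, (trace_mul_tensorBip F ρ (werner d 1)).symm⟩
  · refine ⟨_, hG.tensorBip_wernerTest hd, ?_⟩
    rw [tensorBip_mul_tensorBip, wernerTest_mul_werner_one hd, trace_tensorBip,
      trace_werner_one hd, mul_one]

lemma FGamma_tensorBip_tpow_werner_one (hd : 2 ≤ d) (ρ : Matrix (ι × κ) (ι × κ) ℂ) (n : ℕ)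
    (K : ℝ) :
    FGamma (tensorBip ρ (tpow (werner d 1) n)) K =
      FGamma ρ (K / (((d : ℝ) + 2) / d) ^ n) := by
  induction n generalizing K with
  | zero =>
    rw [tpow_zero, pow_zero, div_one, ← FGamma_submatrix ρ (Equiv.prodUnique ι (Fin 0 → Fin d))
      (Equiv.prodUnique κ (Fin 0 → Fin d))]
    congr 1
    ext x y
    obtain ⟨⟨x1, x2⟩, ⟨x3, x4⟩⟩ := x
    obtain ⟨⟨y1, y2⟩, ⟨y3, y4⟩⟩ := y
    obtain rfl : x2 = y2 := Subsingleton.elim _ _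
    obtain rfl : x4 = y4 := Subsingleton.elim _ _
    simp [tensorBip]
  | succ n ih =>
    have h : tensorBip ρ (tpow (werner d 1) (n + 1)) =
        (tensorBip (tensorBip ρ (tpow (werner d 1) n)) (werner d 1)).submatrix
          (Prod.map
            (((Equiv.refl ι).prodCongr ((Fin.snocEquiv fun _ => Fin d).symm.trans
              (Equiv.prodComm _ _))).trans (Equiv.prodAssoc _ _ _).symm)
            (((Equiv.refl κ).prodCongr ((Fin.snocEquiv fun _ => Fin d).symm.trans
              (Equiv.prodComm _ _))).trans (Equiv.prodAssoc _ _ _).symm))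
          (Prod.map
            (((Equiv.refl ι).prodCongr ((Fin.snocEquiv fun _ => Fin d).symm.trans
              (Equiv.prodComm _ _))).trans (Equiv.prodAssoc _ _ _).symm)
            (((Equiv.refl κ).prodCongr ((Fin.snocEquiv fun _ => Fin d).symm.trans
              (Equiv.prodComm _ _))).trans (Equiv.prodAssoc _ _ _).symm)) := by
      rw [tpow_succ]
      ext x y
      exact (mul_assoc _ _ _).symm
    rw [h, FGamma_submatrix, FGamma_tensorBip_werner_one hd, ih, pow_succ]
    congr 1
    field_simp

omit [Fintype ι] [Fintype κ] [DecidableEq ι] [DecidableEq κ] in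
lemma tpow_tensorBip {ι' κ' : Type*} (ρ : Matrix (ι × κ) (ι × κ) ℂ)
    (σ : Matrix (ι' × κ') (ι' × κ') ℂ) (n : ℕ) :
    tpow (tensorBip ρ σ) n = (tensorBip (tpow ρ n) (tpow σ n)).submatrix
      (Prod.map (Equiv.arrowProdEquivProdArrow (Fin n) (fun _ => ι) (fun _ => ι'))
        (Equiv.arrowProdEquivProdArrow (Fin n) (fun _ => κ) (fun _ => κ')))
      (Prod.map (Equiv.arrowProdEquivProdArrow (Fin n) (fun _ => ι) (fun _ => ι'))
        (Equiv.arrowProdEquivProdArrow (Fin n) (fun _ => κ) (fun _ => κ'))) := by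
  ext x y
  exact Finset.prod_mul_distrib

lemma FGamma_tpow_tensorBip_werner_one (hd : 2 ≤ d) (ρ : Matrix (ι × κ) (ι × κ) ℂ) (n : ℕ)
    (K : ℝ) :
    FGamma (tpow (tensorBip ρ (werner d 1)) n) K =
      FGamma (tpow ρ n) (K / (((d : ℝ) + 2) / d) ^ n) := by
  rw [tpow_tensorBip, FGamma_submatrix, FGamma_tensorBip_tpow_werner_one hd]

lemma FGamma_one_tensorBip (σ : Matrix (ι × κ) (ι × κ) ℂ) (K : ℝ) :
    FGamma (tensorBip (1 : Matrix (Fin 1 × Fin 1) (Fin 1 × Fin 1) ℂ) σ) K = FGamma σ K := by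
  rw [← FGamma_submatrix σ (Equiv.uniqueProd ι (Fin 1)) (Equiv.uniqueProd κ (Fin 1))]
  congr 1
  ext x y
  obtain ⟨⟨x1, x2⟩, ⟨x3, x4⟩⟩ := x
  obtain ⟨⟨y1, y2⟩, ⟨y3, y4⟩⟩ := y
  obtain rfl : x1 = y1 := Subsingleton.elim _ _
  obtain rfl : x3 = y3 := Subsingleton.elim _ _
  simp [tensorBip]

lemma FGamma_one_fin_one {K : ℝ} (hK : 0 < K) :
    FGamma (1 : Matrix (Fin 1 × Fin 1) (Fin 1 × Fin 1) ℂ) K = min 1 (1 / K) := by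
  have h0 : (1 : Matrix (Fin 1 × Fin 1) (Fin 1 × Fin 1) ℂ).PosSemidef := PosSemidef.one
  have h1 : (1 : Matrix (Fin 1 × Fin 1) (Fin 1 × Fin 1) ℂ).trace = 1 := by simp
  refine le_antisymm (le_min (FGamma_le_one h0 h1 hK) ?_)
    (le_FGamma h0 h1 (by positivity) (min_le_left _ _) (min_le_right _ _))
  simpa using FGamma_le_div h0 h1 hK

lemma one_le_add_two_div (hd : 2 ≤ d) : 1 ≤ ((d : ℝ) + 2) / d := by
  have : (0 : ℝ) < d := by exact_mod_cast (by lia : 0 < d)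
  rw [le_div_iff₀ this]
  linarith

lemma DGamma_eq_sSup_rateSet (ρ : Matrix (ι × κ) (ι × κ) ℂ) :
    DGamma ρ = sSup (rateSet fun n K => FGamma (tpow ρ n) K) := rfl

omit [DecidableEq ι] [DecidableEq κ] in
lemma one_le_card_mul_card {ρ : Matrix (ι × κ) (ι × κ) ℂ} (hρ1 : ρ.trace = 1) :
    (1 : ℝ) ≤ (Fintype.card ι * Fintype.card κ : ℕ) := by
  rw [← Fintype.card_prod, Nat.one_le_cast, Nat.one_le_iff_ne_zero]
  intro h
  have := Fintype.card_eq_zero_iff.mp h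
  simp [trace] at hρ1

lemma DGamma_tensorBip_werner_one_eq_add_logb (hd : 2 ≤ d) {ρ : Matrix (ι × κ) (ι × κ) ℂ}
    (hρ : ρ.PosSemidef) (hρ1 : ρ.trace = 1) :
    DGamma (tensorBip ρ (werner d 1)) = DGamma ρ + Real.logb 2 (((d : ℝ) + 2) / d) := by
  simp only [DGamma_eq_sSup_rateSet, FGamma_tpow_tensorBip_werner_one hd]
  exact (isFidelityFamily_FGamma_tpow hρ hρ1).sSup_rateSet_rescale (one_le_card_mul_card hρ1)
    (one_le_add_two_div hd)

lemma DGamma_one_fin_one : DGamma (1 : Matrix (Fin 1 × Fin 1) (Fin 1 × Fin 1) ℂ) = 0 := by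
  have h1 : (1 : Matrix (Fin 1 × Fin 1) (Fin 1 × Fin 1) ℂ).trace = 1 := by simp
  have h := isFidelityFamily_FGamma_tpow PosSemidef.one h1
  rw [DGamma_eq_sSup_rateSet]
  exact le_antisymm (by simpa using h.sSup_rateSet_le (one_le_card_mul_card h1))
    (h.sSup_rateSet_nonneg (one_le_card_mul_card h1))

lemma DGamma_one_tensorBip (σ : Matrix (ι × κ) (ι × κ) ℂ) :
    DGamma (tensorBip (1 : Matrix (Fin 1 × Fin 1) (Fin 1 × Fin 1) ℂ) σ) = DGamma σ := by
  have h : tensorBip (1 : Matrix (Fin 1 × Fin 1) (Fin 1 × Fin 1) ℂ) σ =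
      σ.submatrix (Prod.map Prod.snd Prod.snd) (Prod.map Prod.snd Prod.snd) := by
    ext x y
    obtain ⟨⟨x1, x2⟩, ⟨x3, x4⟩⟩ := x
    obtain ⟨⟨y1, y2⟩, ⟨y3, y4⟩⟩ := y
    obtain rfl : x1 = y1 := Subsingleton.elim _ _
    obtain rfl : x3 = y3 := Subsingleton.elim _ _
    simp [tensorBip]
  have h' (n : ℕ) : tpow (tensorBip (1 : Matrix (Fin 1 × Fin 1) (Fin 1 × Fin 1) ℂ) σ) n =
      (tpow σ n).submatrix
        (Prod.map ((Equiv.refl (Fin n)).arrowCongr (Equiv.uniqueProd ι (Fin 1)))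
          ((Equiv.refl (Fin n)).arrowCongr (Equiv.uniqueProd κ (Fin 1))))
        (Prod.map ((Equiv.refl (Fin n)).arrowCongr (Equiv.uniqueProd ι (Fin 1)))
          ((Equiv.refl (Fin n)).arrowCongr (Equiv.uniqueProd κ (Fin 1)))) := by
    rw [h]
    rfl
  simp only [DGamma_eq_sSup_rateSet, h', FGamma_submatrix]

lemma FGamma_werner_one (hd : 2 ≤ d) {K : ℝ} (hK : 0 < K) :
    FGamma (werner d 1) K = min 1 (((d : ℝ) + 2) / ((d : ℝ) * K)) := by
  have : (0 : ℝ) < d := by exact_mod_cast (by lia : 0 < d)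
  rw [← FGamma_one_tensorBip, FGamma_tensorBip_werner_one hd, FGamma_one_fin_one (by positivity),
    one_div_div]

lemma DGamma_werner_one (hd : 2 ≤ d) :
    DGamma (werner d 1) = Real.logb 2 (((d : ℝ) + 2) / d) := by
  rw [← DGamma_one_tensorBip, DGamma_tensorBip_werner_one_eq_add_logb hd PosSemidef.one (by simp),
    DGamma_one_fin_one, zero_add]

end Werner

/-- The antisymmetric Werner state: its fidelity and p.p.t. distillable entanglement,
and its additivity properties. -/
theorem antisymmetric_werner {a b : ℕ} (d : ℕ) (hd : 2 ≤ d)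
    (ρ : Matrix (Fin a × Fin b) (Fin a × Fin b) ℂ)
    (hρ : ρ.PosSemidef) (hρtr : ρ.trace = 1) :
    (∀ K : ℝ, 0 < K →
      FGamma (werner d 1) K = min 1 (((d : ℝ) + 2) / ((d : ℝ) * K))) ∧
    DGamma (werner d 1) = Real.logb 2 (((d : ℝ) + 2) / (d : ℝ)) ∧
    (∀ K : ℝ, 0 < K →
      FGamma (tensorBip ρ (werner d 1)) K = FGamma ρ ((d : ℝ) * K / ((d : ℝ) + 2))) ∧
    DGamma (tensorBip ρ (werner d 1)) = DGamma ρ + DGamma (werner d 1) := by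
  refine ⟨fun K hK => FGamma_werner_one hd hK, DGamma_werner_one hd,
    fun K _ => FGamma_tensorBip_werner_one hd ρ K, ?_⟩
  rw [DGamma_werner_one hd, DGamma_tensorBip_werner_one_eq_add_logb hd hρ hρtr]
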